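/- If I is an independent family of subsets of ℕ, then fil(I) is a proper filter on ℕ containing all cofinite sets (i.e., ℕ ∈ fil(I), ∅ ∉ fil(I), fil(I) is closed under finite intersections and supersets, and every cofinite subset of ℕ belongs to fil(I)), and id(I) = {ℕ∖X : X ∈ fil(I)} is a proper ideal on ℕ containing all finite sets. -/

import Mathlib

/-- Finite partial functions from `I` to `{0,1}` (encoded as `Set ℕ → Option Bool`). -/
def FF (I : Set (Set ℕ)) : Set (Set ℕ → Option Bool) :=
  {g | {A : Set ℕ | g A ≠ none}.Finite ∧ ∀ A : Set ℕ, g A ≠ none → A ∈ I}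

/-- `g` extends `g'` as a partial function. -/
def FFExtends (g g' : Set ℕ → Option Bool) : Prop :=
  ∀ (A : Set ℕ) (b : Bool), g' A = some b → g A = some b

/-- The boolean combination `I^g`: intersection of the sets mapped to `1`
and complements of the sets mapped to `0` (so `I^∅ = ℕ`). -/
def boolComb (g : Set ℕ → Option Bool) : Set ℕ :=
  {n | ∀ A : Set ℕ, (g A = some true → n ∈ A) ∧ (g A = some false → n ∉ A)}

/-- `I` is an independent family. -/
def IndepFam (I : Set (Set ℕ)) : Prop :=
  (∀ A ∈ I, A.Infinite) ∧ ∀ g ∈ FF I, (boolComb g).Infinite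

/-- The density filter `fil(I)`. -/
def densityFil (I : Set (Set ℕ)) : Set (Set ℕ) :=
  {X | ∀ g' ∈ FF I, ∃ g ∈ FF I, FFExtends g g' ∧ (boolComb g \ X).Finite}

/-- The density ideal `id(I)`. -/
def densityIdl (I : Set (Set ℕ)) : Set (Set ℕ) :=
  {X | ∀ g' ∈ FF I, ∃ g ∈ FF I, FFExtends g g' ∧ (boolComb g ∩ X).Finite}

/-- `I` is densely maximal. -/
def DenselyMaximal (I : Set (Set ℕ)) : Prop :=
  ∀ X : Set ℕ, X.Infinite → ∀ g' ∈ FF I, ∃ g ∈ FF I, FFExtends g g' ∧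
    ((boolComb g ∩ X).Finite ∨ (boolComb g \ X).Finite)

theorem const_none_mem_FF (I : Set (Set ℕ)) : (fun _ => none) ∈ FF I := by
  simp [FF]

theorem FFExtends.refl (g : Set ℕ → Option Bool) : FFExtends g g := fun _ _ h => h

theorem FFExtends.trans {g₁ g₂ g₃ : Set ℕ → Option Bool} (h : FFExtends g₁ g₂)
    (h' : FFExtends g₂ g₃) : FFExtends g₁ g₃ := fun A b hA => h A b (h' A b hA)

theorem FFExtends.boolComb_subset {g g' : Set ℕ → Option Bool} (h : FFExtends g g') :
    boolComb g ⊆ boolComb g' :=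
  fun _ hn A => ⟨fun hA => (hn A).1 (h A _ hA), fun hA => (hn A).2 (h A _ hA)⟩

theorem mem_densityIdl_iff_compl_mem_densityFil {I : Set (Set ℕ)} {X : Set ℕ} :
    X ∈ densityIdl I ↔ Xᶜ ∈ densityFil I := by
  simp only [densityIdl, densityFil, Set.mem_ofPred_eq, Set.sdiff_compl]

theorem densityFil_inter_mem {I : Set (Set ℕ)} {X Y : Set ℕ} (hX : X ∈ densityFil I)
    (hY : Y ∈ densityFil I) : X ∩ Y ∈ densityFil I := by
  intro g' hg'
  obtain ⟨g₁, hg₁, hext₁, hfin₁⟩ := hX g' hg'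
  obtain ⟨g₂, hg₂, hext₂, hfin₂⟩ := hY g₁ hg₁
  refine ⟨g₂, hg₂, hext₂.trans hext₁, ?_⟩
  rw [Set.sdiff_inter]
  exact (hfin₁.subset (Set.sdiff_subset_sdiff_left hext₂.boolComb_subset)).union hfin₂

theorem densityFil_mem_of_subset {I : Set (Set ℕ)} {X Y : Set ℕ} (hX : X ∈ densityFil I)
    (hXY : X ⊆ Y) : Y ∈ densityFil I := by
  intro g' hg'
  obtain ⟨g, hg, hext, hfin⟩ := hX g' hg'
  exact ⟨g, hg, hext, hfin.subset (Set.sdiff_subset_sdiff_right hXY)⟩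

theorem mem_densityFil_of_finite_compl (I : Set (Set ℕ)) {X : Set ℕ} (hX : Xᶜ.Finite) :
    X ∈ densityFil I :=
  fun g' hg' => ⟨g', hg', FFExtends.refl g', hX.subset fun _ hn => hn.2⟩

theorem IndepFam.empty_notMem_densityFil {I : Set (Set ℕ)} (hI : IndepFam I) :
    ∅ ∉ densityFil I := by
  intro h
  obtain ⟨g, hg, -, hfin⟩ := h _ (const_none_mem_FF I)
  rw [Set.sdiff_empty] at hfin
  exact hI.2 g hg hfin

/-- For an independent family `I`, `fil(I)` is a proper filter on `ℕ` containing all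
cofinite sets, and `id(I)` is the ideal of complements of members of `fil(I)`, a proper
ideal containing all finite sets. -/
theorem densityFil_isProperFilter_and_densityIdl_dual (I : Set (Set ℕ)) (hI : IndepFam I) :
    Set.univ ∈ densityFil I ∧
    ∅ ∉ densityFil I ∧
    (∀ X ∈ densityFil I, ∀ Y ∈ densityFil I, X ∩ Y ∈ densityFil I) ∧
    (∀ X ∈ densityFil I, ∀ Y : Set ℕ, X ⊆ Y → Y ∈ densityFil I) ∧
    (∀ X : Set ℕ, Xᶜ.Finite → X ∈ densityFil I) ∧
    densityIdl I = {Y : Set ℕ | ∃ X ∈ densityFil I, Y = Set.univ \ X} ∧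
    (∀ X : Set ℕ, X.Finite → X ∈ densityIdl I) ∧
    Set.univ ∉ densityIdl I ∧
    (∀ X ∈ densityIdl I, ∀ Y : Set ℕ, Y ⊆ X → Y ∈ densityIdl I) ∧
    (∀ X ∈ densityIdl I, ∀ Y ∈ densityIdl I, X ∪ Y ∈ densityIdl I) := by
  refine ⟨mem_densityFil_of_finite_compl I (by simp), hI.empty_notMem_densityFil,
    fun X hX Y hY => densityFil_inter_mem hX hY,
    fun X hX Y hXY => densityFil_mem_of_subset hX hXY,
    fun X hX => mem_densityFil_of_finite_compl I hX, ?_, ?_, ?_, ?_, ?_⟩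
  · ext Y
    rw [mem_densityIdl_iff_compl_mem_densityFil]
    constructor
    · intro hY
      exact ⟨Yᶜ, hY, by rw [← Set.compl_eq_univ_sdiff, compl_compl]⟩
    · rintro ⟨X, hX, rfl⟩
      rwa [← Set.compl_eq_univ_sdiff, compl_compl]
  · intro X hX
    rw [mem_densityIdl_iff_compl_mem_densityFil]
    exact mem_densityFil_of_finite_compl I (by rwa [compl_compl])
  · rw [mem_densityIdl_iff_compl_mem_densityFil, Set.compl_univ]
    exact hI.empty_notMem_densityFil
  · intro X hX Y hYX
    rw [mem_densityIdl_iff_compl_mem_densityFil] at hX ⊢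
    exact densityFil_mem_of_subset hX (Set.compl_subset_compl.mpr hYX)
  · intro X hX Y hY
    rw [mem_densityIdl_iff_compl_mem_densityFil] at hX hY ⊢
    rw [Set.compl_union]
    exact densityFil_inter_mem hX hY
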